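/- arXiv:2504.02669 — 2 statements merged into one kernel-verified Lean document; each statement's English description precedes it below -/
import Mathlib

section
/- Let ν ∈ (0,1], δ₀ ∈ (0,1/2), and let k be a nonzero integer. Let U : [0,∞) × [-1,1] → ℝ be smooth with |∂_y U(t,y) - 1| ≤ δ₀ for all t ≥ 0, y ∈ [-1,1]. Let θ : [0,∞) × [-1,1] → ℂ be smooth with θ(t,-1) = θ(t,1) = 0 for all t ≥ 0, satisfying ∂_t θ + i·k·U·θ - ν·(∂_y² θ - k²·θ) = 0 on [0,∞) × [-1,1]. Define E(t) := 16·‖θ(t,·)‖²_{L²} + ν^{2/3}·|k|^{-2/3}·‖∂_y θ(t,·)‖²_{L²} + ν^{1/3}·|k|^{-4/3}·Re⟨i·k·θ(t,·), ∂_y θ(t,·)⟩. Then E is differentiable and for every t ≥ 0: E'(t) + ν·(k²·‖θ(t,·)‖²_{L²} + ‖∂_y θ(t,·)‖²_{L²}) + ν^{5/3}·|k|^{-2/3}·(k²·‖∂_y θ(t,·)‖²_{L²} + ‖∂_y² θ(t,·)‖²_{L²}) + (1/4)·ν^{1/3}·|k|^{2/3}·‖θ(t,·)‖²_{L²} ≤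 0. -/
open Set

section PartialDerivatives

variable {F : Type*} [NormedAddCommGroup F] [NormedSpace ℝ F] {f : ℝ → ℝ → F}

theorem hasDerivAt_right_of_uncurry (hf : Differentiable ℝ (Function.uncurry f)) (t y : ℝ) :
    HasDerivAt (f t) (fderiv ℝ (Function.uncurry f) (t, y) (0, 1)) y :=
  (hf (t, y)).hasFDerivAt.comp_hasDerivAt y ((hasDerivAt_const y t).prodMk (hasDerivAt_id y))

theorem hasDerivAt_left_of_uncurry (hf : Differentiable ℝ (Function.uncurry f)) (t y : ℝ) :
    HasDerivAt (fun s => f s y) (fderiv ℝ (Function.uncurry f) (t, y) (1, 0)) t :=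
  HasFDerivAt.comp_hasDerivAt (f := fun s => (s, y)) t (hf (t, y)).hasFDerivAt
    ((hasDerivAt_id t).prodMk (hasDerivAt_const t y))

theorem contDiff_uncurry_deriv_right (hf : ContDiff ℝ (⊤ : ℕ∞) (Function.uncurry f)) :
    ContDiff ℝ (⊤ : ℕ∞) (Function.uncurry fun t y => deriv (f t) y) := by
  have h : (Function.uncurry fun t y => deriv (f t) y)
      = fun x => fderiv ℝ (Function.uncurry f) x (0, 1) := by
    ext ⟨t, y⟩
    exact (hasDerivAt_right_of_uncurry (hf.differentiable (by simp)) t y).deriv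
  rw [h]
  exact (hf.fderiv_right (m := (⊤ : ℕ∞)) (by simp)).clm_apply contDiff_const

theorem contDiff_uncurry_deriv_left (hf : ContDiff ℝ (⊤ : ℕ∞) (Function.uncurry f)) :
    ContDiff ℝ (⊤ : ℕ∞) (Function.uncurry fun t y => deriv (fun s => f s y) t) := by
  have h : (Function.uncurry fun t y => deriv (fun s => f s y) t)
      = fun x => fderiv ℝ (Function.uncurry f) x (1, 0) := by
    ext ⟨t, y⟩
    exact (hasDerivAt_left_of_uncurry (hf.differentiable (by simp)) t y).deriv
  rw [h]
  exact (hf.fderiv_right (m := (⊤ : ℕ∞)) (by simp)).clm_apply contDiff_const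

theorem deriv_deriv_comm (hf : ContDiff ℝ (⊤ : ℕ∞) (Function.uncurry f)) (t y : ℝ) :
    deriv (fun s => deriv (f s) y) t = deriv (fun z => deriv (fun s => f s z) t) y := by
  have hd : Differentiable ℝ (Function.uncurry f) := hf.differentiable (by simp)
  have hd' : Differentiable ℝ (fderiv ℝ (Function.uncurry f)) :=
    (hf.fderiv_right (m := (⊤ : ℕ∞)) (by simp)).differentiable (by simp)
  have hsymm : IsSymmSndFDerivAt ℝ (Function.uncurry f) (t, y) :=
    hf.contDiffAt.isSymmSndFDerivAt (by simpa using WithTop.coe_le_coe.2 (le_top (a := (2 : ℕ∞))))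
  simp_rw [fun s z => (hasDerivAt_right_of_uncurry hd s z).deriv,
    fun s z => (hasDerivAt_left_of_uncurry hd s z).deriv]
  have hl : HasDerivAt (fun s => fderiv ℝ (Function.uncurry f) (s, y) (0, 1))
      (fderiv ℝ (fderiv ℝ (Function.uncurry f)) (t, y) (1, 0) (0, 1)) t := by
    simpa using (hasDerivAt_left_of_uncurry
      (f := Function.curry (fderiv ℝ (Function.uncurry f))) hd' t y).clm_apply
        (hasDerivAt_const t ((0 : ℝ), (1 : ℝ)))
  have hr : HasDerivAt (fun z => fderiv ℝ (Function.uncurry f) (t, z) (1, 0))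
      (fderiv ℝ (fderiv ℝ (Function.uncurry f)) (t, y) (0, 1) (1, 0)) y := by
    simpa using (hasDerivAt_right_of_uncurry
      (f := Function.curry (fderiv ℝ (Function.uncurry f))) hd' t y).clm_apply
        (hasDerivAt_const y ((1 : ℝ), (0 : ℝ)))
  rw [hl.deriv, hr.deriv, hsymm.eq]

end PartialDerivatives

theorem hasDerivAt_intervalIntegral_of_continuous {F F' : ℝ → ℝ → ℝ}
    (hF : Continuous (Function.uncurry F)) (hF' : Continuous (Function.uncurry F'))
    (hd : ∀ t y, HasDerivAt (fun s => F s y) (F' t y) t) (a b t : ℝ) :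
    HasDerivAt (fun s => ∫ y in a..b, F s y) (∫ y in a..b, F' t y) t := by
  obtain ⟨C, hC⟩ := ((isCompact_closedBall t 1).prod (isCompact_uIcc (a := a) (b := b)))
    |>.exists_bound_of_continuousOn hF'.continuousOn
  have hs : ∀ s, Continuous (F s) := fun s => hF.comp (by fun_prop : Continuous fun y => (s, y))
  have hs' : ∀ s, Continuous (F' s) := fun s => hF'.comp (by fun_prop : Continuous fun y => (s, y))
  refine (intervalIntegral.hasDerivAt_integral_of_dominated_loc_of_deriv_le
    (s := Metric.closedBall t 1) (bound := fun _ => C) (F' := F')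
    (Metric.closedBall_mem_nhds t one_pos) ?_ ((hs t).intervalIntegrable _ _) ?_ ?_ ?_ ?_).2
  · exact .of_forall fun s => (hs s).aestronglyMeasurable
  · exact (hs' t).aestronglyMeasurable
  · exact .of_forall fun y hy s hs => hC (s, y) ⟨hs, uIoc_subset_uIcc hy⟩
  · exact continuous_const.intervalIntegrable _ _
  · exact .of_forall fun y _ s _ => hd s y

/-- The pointwise form of the dissipation estimate: the cross terms produced by the shear and by
the diffusion are absorbed by completing squares. Here `a ^ 3` is the viscosity, `σ * b ^ 3` the
wave number, `c = b⁻¹`, `u` the shear rate, and `(p, q)`, `(p₁, q₁)`, `(p₂, q₂)` are the real and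
imaginary parts of the solution and its first two derivatives. -/
theorem dissipation_density_nonpos {a b c σ u : ℝ} (ha : 0 < a) (hbc : b * c = 1)
    (hσ : σ ^ 2 = 1) (hu : 1 / 2 ≤ u) (hu' : u ≤ 3 / 2) (p q p₁ q₁ p₂ q₂ : ℝ) :
    -32 * a ^ 3 * ((σ * b ^ 3) ^ 2 * (p ^ 2 + q ^ 2) + (p₁ ^ 2 + q₁ ^ 2))
      - 2 * (a ^ 2 * c ^ 2) * (a ^ 3 * ((p₂ ^ 2 + q₂ ^ 2) + (σ * b ^ 3) ^ 2 * (p₁ ^ 2 + q₁ ^ 2))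
        + σ * b ^ 3 * u * (p * q₁ - q * p₁))
      + a * c ^ 4 * (-(σ * b ^ 3) ^ 2 * u * (p ^ 2 + q ^ 2)
        + 2 * a ^ 3 * (σ * b ^ 3) * (p₂ * q₁ - q₂ * p₁)
        - 2 * a ^ 3 * (σ * b ^ 3) ^ 3 * (p * q₁ - q * p₁))
      + a ^ 3 * ((σ * b ^ 3) ^ 2 * (p ^ 2 + q ^ 2) + (p₁ ^ 2 + q₁ ^ 2))
      + a ^ 5 * c ^ 2 * ((σ * b ^ 3) ^ 2 * (p₁ ^ 2 + q₁ ^ 2) + (p₂ ^ 2 + q₂ ^ 2))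
      + 1 / 4 * a * b ^ 2 * (p ^ 2 + q ^ 2) ≤ 0 := by
  have hc2 : c ^ 2 * b ^ 3 = b := by linear_combination (b + b ^ 2 * c) * hbc
  have hc4 : c ^ 4 * b ^ 6 = b ^ 2 := by
    linear_combination (c ^ 2 * b ^ 3 + b) * hc2
  have hc4' : c ^ 4 * b ^ 3 = c := by
    linear_combination c ^ 2 * hc2 + c * hbc
  have hc2' : c ^ 2 * b ^ 6 = b ^ 4 := by linear_combination b ^ 3 * hc2
  have hc9 : c ^ 4 * b ^ 9 = b ^ 5 := by linear_combination b ^ 3 * hc4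
  have hσ3 : σ ^ 3 = σ := by linear_combination σ * hσ
  have s1 : 0 ≤ a * ((b * p / 2 + 2 * σ * a * u * q₁) ^ 2
      + (b * q / 2 - 2 * σ * a * u * p₁) ^ 2) := by positivity
  have s2 : 0 ≤ a ^ 3 * ((a * c * p₂ - σ * q₁) ^ 2 + (a * c * q₂ + σ * p₁) ^ 2) := by positivity
  have s3 : 0 ≤ a ^ 3 * b ^ 4 * ((b * p + σ * a * q₁) ^ 2 + (b * q - σ * a * p₁) ^ 2) := by
    positivity
  have s4 : 0 ≤ a * b ^ 2 * (u - 1 / 2) * (p ^ 2 + q ^ 2) :=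
    mul_nonneg (mul_nonneg (by positivity) (by linarith)) (by positivity)
  have s5 : 0 ≤ a ^ 3 * (9 - 4 * u ^ 2) * (p₁ ^ 2 + q₁ ^ 2) :=
    mul_nonneg (mul_nonneg (by positivity) (by nlinarith)) (by positivity)
  have s6 : 0 ≤ a ^ 3 * b ^ 6 * (p ^ 2 + q ^ 2) := by positivity
  have s7 : 0 ≤ a ^ 3 * (p₁ ^ 2 + q₁ ^ 2) := by positivity
  have e1 : (σ * b ^ 3) ^ 2 = b ^ 6 := by linear_combination b ^ 6 * hσ
  have e3 : (σ * b ^ 3) ^ 3 = σ * b ^ 9 := by linear_combination b ^ 9 * hσ3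
  have r1 : a * ((b * p / 2 + 2 * σ * a * u * q₁) ^ 2 + (b * q / 2 - 2 * σ * a * u * p₁) ^ 2)
      = a * b ^ 2 / 4 * (p ^ 2 + q ^ 2) + 2 * a ^ 2 * b * σ * u * (p * q₁ - q * p₁)
        + 4 * a ^ 3 * u ^ 2 * (p₁ ^ 2 + q₁ ^ 2) := by
    linear_combination 4 * a ^ 3 * u ^ 2 * (p₁ ^ 2 + q₁ ^ 2) * hσ
  have r2 : a ^ 3 * ((a * c * p₂ - σ * q₁) ^ 2 + (a * c * q₂ + σ * p₁) ^ 2)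
      = a ^ 5 * c ^ 2 * (p₂ ^ 2 + q₂ ^ 2) - 2 * a ^ 4 * c * σ * (p₂ * q₁ - q₂ * p₁)
        + a ^ 3 * (p₁ ^ 2 + q₁ ^ 2) := by
    linear_combination a ^ 3 * (p₁ ^ 2 + q₁ ^ 2) * hσ
  have r3 : a ^ 3 * b ^ 4 * ((b * p + σ * a * q₁) ^ 2 + (b * q - σ * a * p₁) ^ 2)
      = a ^ 3 * b ^ 6 * (p ^ 2 + q ^ 2) + 2 * a ^ 4 * b ^ 5 * σ * (p * q₁ - q * p₁)
        + a ^ 5 * b ^ 4 * (p₁ ^ 2 + q₁ ^ 2) := by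
    linear_combination a ^ 5 * b ^ 4 * (p₁ ^ 2 + q₁ ^ 2) * hσ
  rw [r1] at s1
  rw [r2] at s2
  rw [r3] at s3
  rw [e1, e3]
  have key : -32 * a ^ 3 * (b ^ 6 * (p ^ 2 + q ^ 2) + (p₁ ^ 2 + q₁ ^ 2))
      - 2 * (a ^ 2 * c ^ 2) * (a ^ 3 * ((p₂ ^ 2 + q₂ ^ 2) + b ^ 6 * (p₁ ^ 2 + q₁ ^ 2))
        + σ * b ^ 3 * u * (p * q₁ - q * p₁))
      + a * c ^ 4 * (-b ^ 6 * u * (p ^ 2 + q ^ 2)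
        + 2 * a ^ 3 * (σ * b ^ 3) * (p₂ * q₁ - q₂ * p₁)
        - 2 * a ^ 3 * (σ * b ^ 9) * (p * q₁ - q * p₁))
      + a ^ 3 * (b ^ 6 * (p ^ 2 + q ^ 2) + (p₁ ^ 2 + q₁ ^ 2))
      + a ^ 5 * c ^ 2 * (b ^ 6 * (p₁ ^ 2 + q₁ ^ 2) + (p₂ ^ 2 + q₂ ^ 2))
      + 1 / 4 * a * b ^ 2 * (p ^ 2 + q ^ 2)
      = -31 * a ^ 3 * (b ^ 6 * (p ^ 2 + q ^ 2) + (p₁ ^ 2 + q₁ ^ 2))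
      - a ^ 5 * c ^ 2 * (p₂ ^ 2 + q₂ ^ 2) - a ^ 5 * b ^ 4 * (p₁ ^ 2 + q₁ ^ 2)
      - 2 * a ^ 2 * b * σ * u * (p * q₁ - q * p₁)
      - a * b ^ 2 * u * (p ^ 2 + q ^ 2)
      + 2 * a ^ 4 * c * σ * (p₂ * q₁ - q₂ * p₁)
      - 2 * a ^ 4 * b ^ 5 * σ * (p * q₁ - q * p₁)
      + 1 / 4 * a * b ^ 2 * (p ^ 2 + q ^ 2) := by
    linear_combination (-2 * a ^ 2 * σ * u * (p * q₁ - q * p₁)) * hc2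
      - a ^ 5 * (p₁ ^ 2 + q₁ ^ 2) * hc2' - a * u * (p ^ 2 + q ^ 2) * hc4
      + 2 * a ^ 4 * σ * (p₂ * q₁ - q₂ * p₁) * hc4' - 2 * a ^ 4 * σ * (p * q₁ - q * p₁) * hc9
  rw [key]
  linear_combination s1 + s2 + s3 + s4 + s5 + 30 * s6 + 21 * s7

theorem HasDerivAt.complex_re {f : ℝ → ℂ} {f' : ℂ} {x : ℝ} (h : HasDerivAt f f' x) :
    HasDerivAt (fun s => (f s).re) f'.re x :=
  Complex.reCLM.hasFDerivAt.comp_hasDerivAt x h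

theorem HasDerivAt.complex_im {f : ℝ → ℂ} {f' : ℂ} {x : ℝ} (h : HasDerivAt f f' x) :
    HasDerivAt (fun s => (f s).im) f'.im x :=
  Complex.imCLM.hasFDerivAt.comp_hasDerivAt x h

/-- The hypocoercive energy density of a function with value `z` and spatial derivative `z₁`. -/
noncomputable def energyDensity (α β κ : ℝ) (z z₁ : ℂ) : ℝ :=
  16 * (z.re ^ 2 + z.im ^ 2) + α * (z₁.re ^ 2 + z₁.im ^ 2)
    + β * κ * (z.re * z₁.im - z.im * z₁.re)

/-- The time derivative of `energyDensity`, with `w` and `w₁` the time derivatives of `z`, `z₁`. -/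
noncomputable def energyRate (α β κ : ℝ) (z z₁ w w₁ : ℂ) : ℝ :=
  32 * (z.re * w.re + z.im * w.im) + 2 * α * (z₁.re * w₁.re + z₁.im * w₁.im)
    + β * κ * (w.re * z₁.im + z.re * w₁.im - w.im * z₁.re - z.im * w₁.re)

/-- The quantity whose spatial derivative is removed from `energyRate` by integrating by parts. -/
noncomputable def energyFlux (ν α β κ u : ℝ) (z z₁ w : ℂ) : ℝ :=
  (32 * ν + 2 * α * ν * κ ^ 2) * (z.re * z₁.re + z.im * z₁.im)
    + 2 * α * (w.re * z₁.re + w.im * z₁.im)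
    + 2 * α * κ * (u * (z.re * z₁.im - z.im * z₁.re))
    + β * κ * (z.re * w.im - z.im * w.re)
    + β * κ ^ 2 * (u * (z.re ^ 2 + z.im ^ 2))

/-- The spatial derivative of `energyFlux`. -/
noncomputable def energyFluxDeriv (ν α β κ u u₁ : ℝ) (z z₁ z₂ w w₁ : ℂ) : ℝ :=
  (32 * ν + 2 * α * ν * κ ^ 2)
      * (z₁.re ^ 2 + z.re * z₂.re + z₁.im ^ 2 + z.im * z₂.im)
    + 2 * α * (w₁.re * z₁.re + w.re * z₂.re + w₁.im * z₁.im + w.im * z₂.im)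
    + 2 * α * κ * (u₁ * (z.re * z₁.im - z.im * z₁.re) + u * (z.re * z₂.im - z.im * z₂.re))
    + β * κ * (z₁.re * w.im + z.re * w₁.im - z₁.im * w.re - z.im * w₁.re)
    + β * κ ^ 2 * (u₁ * (z.re ^ 2 + z.im ^ 2) + 2 * u * (z.re * z₁.re + z.im * z₁.im))

section Energy

variable {θ : ℝ → ℝ → ℂ}

theorem hasDerivAt_integral_energyDensity (hθ : ContDiff ℝ (⊤ : ℕ∞) (Function.uncurry θ))
    (α β κ t : ℝ) :
    HasDerivAt (fun s => ∫ y in (-1 : ℝ)..1, energyDensity α β κ (θ s y) (deriv (θ s) y))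
      (∫ y in (-1 : ℝ)..1, energyRate α β κ (θ t y) (deriv (θ t) y) (deriv (fun s => θ s y) t)
        (deriv (fun z => deriv (fun s => θ s z) t) y)) t := by
  have hθy := contDiff_uncurry_deriv_right hθ
  have hθt := contDiff_uncurry_deriv_left hθ
  have hθty := contDiff_uncurry_deriv_right hθt
  have c0 := hθ.continuous
  have c1 := hθy.continuous
  have ct := hθt.continuous
  have cty := hθty.continuous
  simp only [Function.uncurry_def] at c0 c1 ct cty
  refine hasDerivAt_intervalIntegral_of_continuous
    (F := fun s y => energyDensity α β κ (θ s y) (deriv (θ s) y))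
    (F' := fun t y => energyRate α β κ (θ t y) (deriv (θ t) y) (deriv (fun s => θ s y) t)
        (deriv (fun z => deriv (fun s => θ s z) t) y)) ?_ ?_ (fun s y => ?_) _ _ t
  · simp only [Function.uncurry_def, energyDensity]
    fun_prop
  · simp only [Function.uncurry_def, energyRate]
    fun_prop
  · have d0 : HasDerivAt (fun s => θ s y) (deriv (fun s => θ s y) s) s :=
      (hasDerivAt_left_of_uncurry (hθ.differentiable (by simp)) s y).differentiableAt.hasDerivAt
    have d1 : HasDerivAt (fun s => deriv (θ s) y)
        (deriv (fun z => deriv (fun s => θ s z) s) y) s := by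
      rw [← deriv_deriv_comm hθ]
      exact (hasDerivAt_left_of_uncurry (f := fun t y => deriv (θ t) y)
        (hθy.differentiable (by simp)) s y).differentiableAt.hasDerivAt
    have r0 := d0.complex_re
    have i0 := d0.complex_im
    have r1 := d1.complex_re
    have i1 := d1.complex_im
    refine HasDerivAt.congr_deriv (((((r0.fun_pow 2).fun_add (i0.fun_pow 2)).const_mul 16).fun_add
      (((r1.fun_pow 2).fun_add (i1.fun_pow 2)).const_mul α)).fun_add
      (((r0.fun_mul i1).fun_sub (i0.fun_mul r1)).const_mul (β * κ))) ?_
    simp only [energyRate]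
    push_cast
    ring

theorem integral_energyFluxDeriv_eq_zero {U : ℝ → ℝ → ℝ}
    (hU : ContDiff ℝ (⊤ : ℕ∞) (Function.uncurry U))
    (hθ : ContDiff ℝ (⊤ : ℕ∞) (Function.uncurry θ))
    (hbd : ∀ t ≥ (0 : ℝ), θ t (-1) = 0 ∧ θ t 1 = 0) {t : ℝ} (ht : 0 ≤ t) (ν α β κ : ℝ) :
    ∫ y in (-1 : ℝ)..1, energyFluxDeriv ν α β κ (U t y) (deriv (U t) y) (θ t y) (deriv (θ t) y)
      (deriv (deriv (θ t)) y) (deriv (fun s => θ s y) t)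
      (deriv (fun z => deriv (fun s => θ s z) t) y) = 0 := by
  have hθy := contDiff_uncurry_deriv_right hθ
  have hθyy := contDiff_uncurry_deriv_right hθy
  have hθt := contDiff_uncurry_deriv_left hθ
  have hθty := contDiff_uncurry_deriv_right hθt
  have hUy := contDiff_uncurry_deriv_right hU
  have hslice : Continuous fun y : ℝ => (t, y) := by fun_prop
  have cU : Continuous (U t) := hU.continuous.comp hslice
  have cUy : Continuous (deriv (U t)) := hUy.continuous.comp hslice
  have c0 : Continuous (θ t) := hθ.continuous.comp hslice
  have c1 : Continuous (deriv (θ t)) := hθy.continuous.comp hslice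
  have c2 : Continuous (deriv (deriv (θ t))) := hθyy.continuous.comp hslice
  have ct : Continuous (fun y => deriv (fun s => θ s y) t) := hθt.continuous.comp hslice
  have cty : Continuous (deriv (fun z => deriv (fun s => θ s z) t)) :=
    hθty.continuous.comp hslice
  have hzero : ∀ z : ℝ, (∀ s ≥ (0 : ℝ), θ s z = 0) → deriv (fun s => θ s z) t = 0 := by
    intro z hz
    have h := (hasDerivAt_left_of_uncurry (hθ.differentiable (by simp)) t z).differentiableAt
      |>.hasDerivAt.hasDerivWithinAt (s := Ici 0)
    exact (uniqueDiffOn_Ici (0 : ℝ) t ht).eq_deriv _ h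
      ((hasDerivWithinAt_const t (Ici 0) (0 : ℂ)).congr (fun s hs => hz s hs) (hz t ht))
  rw [intervalIntegral.integral_eq_sub_of_hasDerivAt (f := fun y => energyFlux ν α β κ (U t y)
    (θ t y) (deriv (θ t) y) (deriv (fun s => θ s y) t))]
  · simp [energyFlux, hbd t ht, hzero 1 fun s hs => (hbd s hs).2,
      hzero (-1) fun s hs => (hbd s hs).1]
  · intro y _
    have dU : HasDerivAt (U t) (deriv (U t) y) y :=
      (hasDerivAt_right_of_uncurry (hU.differentiable (by simp)) t y).differentiableAt.hasDerivAt
    have d0 : HasDerivAt (θ t) (deriv (θ t) y) y :=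
      (hasDerivAt_right_of_uncurry (hθ.differentiable (by simp)) t y).differentiableAt.hasDerivAt
    have d1 : HasDerivAt (deriv (θ t)) (deriv (deriv (θ t)) y) y :=
      (hasDerivAt_right_of_uncurry (f := fun t y => deriv (θ t) y)
        (hθy.differentiable (by simp)) t y).differentiableAt.hasDerivAt
    have dt : HasDerivAt (fun y => deriv (fun s => θ s y) t)
        (deriv (fun z => deriv (fun s => θ s z) t) y) y :=
      (hasDerivAt_right_of_uncurry (f := fun t y => deriv (fun s => θ s y) t)
        (hθt.differentiable (by simp)) t y).differentiableAt.hasDerivAt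
    have r0 := d0.complex_re
    have i0 := d0.complex_im
    have r1 := d1.complex_re
    have i1 := d1.complex_im
    have rt := dt.complex_re
    have it := dt.complex_im
    refine HasDerivAt.congr_deriv
      ((((((r0.fun_mul r1).fun_add (i0.fun_mul i1)).const_mul (32 * ν + 2 * α * ν * κ ^ 2)).fun_add
      (((rt.fun_mul r1).fun_add (it.fun_mul i1)).const_mul (2 * α))).fun_add
      ((dU.fun_mul ((r0.fun_mul i1).fun_sub (i0.fun_mul r1))).const_mul (2 * α * κ))).fun_add
      (((r0.fun_mul it).fun_sub (i0.fun_mul rt)).const_mul (β * κ)) |>.fun_add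
      ((dU.fun_mul ((r0.fun_pow 2).fun_add (i0.fun_pow 2))).const_mul (β * κ ^ 2))) ?_
    simp only [energyFluxDeriv]
    push_cast
    ring
  · refine Continuous.intervalIntegrable ?_ _ _
    simp only [energyFluxDeriv]
    fun_prop

end Energy

theorem stmt_17 (ν δ₀ : ℝ) (hν : ν ∈ Ioc (0:ℝ) 1) (hδ : δ₀ ∈ Ioo (0:ℝ) (1/2))
    (k : ℤ) (hk : k ≠ 0)
    (U : ℝ → ℝ → ℝ) (hU : ContDiff ℝ (⊤ : ℕ∞) (Function.uncurry U))
    (hU' : ∀ t ≥ (0:ℝ), ∀ y ∈ Icc (-1:ℝ) 1, |deriv (U t) y - 1| ≤ δ₀)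
    (θ : ℝ → ℝ → ℂ) (hθ : ContDiff ℝ (⊤ : ℕ∞) (Function.uncurry θ))
    (hbd : ∀ t ≥ (0:ℝ), θ t (-1) = 0 ∧ θ t 1 = 0)
    (hpde : ∀ t ≥ (0:ℝ), ∀ y ∈ Icc (-1:ℝ) 1,
      deriv (fun s => θ s y) t + Complex.I * (k : ℂ) * (U t y : ℂ) * θ t y
        - (ν : ℂ) * (deriv (deriv (θ t)) y - (k : ℂ)^2 * θ t y) = 0)
    (E : ℝ → ℝ)
    (hE : ∀ t, E t = 16 * (∫ y in (-1:ℝ)..1, ‖θ t y‖^2)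
      + ν ^ ((2:ℝ)/3) * |(k : ℝ)| ^ (-(2:ℝ)/3) * (∫ y in (-1:ℝ)..1, ‖deriv (θ t) y‖^2)
      + ν ^ ((1:ℝ)/3) * |(k : ℝ)| ^ (-(4:ℝ)/3) *
          (∫ y in (-1:ℝ)..1,
            Complex.I * (k : ℂ) * θ t y * (starRingEnd ℂ) (deriv (θ t) y)).re) :
    ∀ t ≥ (0:ℝ), ∃ d : ℝ, HasDerivWithinAt E d (Ici 0) t ∧
      d + ν * ((k : ℝ)^2 * (∫ y in (-1:ℝ)..1, ‖θ t y‖^2)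
            + (∫ y in (-1:ℝ)..1, ‖deriv (θ t) y‖^2))
        + ν ^ ((5:ℝ)/3) * |(k : ℝ)| ^ (-(2:ℝ)/3) *
            ((k : ℝ)^2 * (∫ y in (-1:ℝ)..1, ‖deriv (θ t) y‖^2)
              + (∫ y in (-1:ℝ)..1, ‖deriv (deriv (θ t)) y‖^2))
        + (1/4) * ν ^ ((1:ℝ)/3) * |(k : ℝ)| ^ ((2:ℝ)/3) *
            (∫ y in (-1:ℝ)..1, ‖θ t y‖^2) ≤ 0 := by
  intro t ht
  obtain ⟨hν0, -⟩ := hν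
  obtain ⟨κ, hκ⟩ : ∃ κ : ℝ, κ = k := ⟨_, rfl⟩
  have hκc : (k : ℂ) = (κ : ℂ) := by rw [hκ]; norm_cast
  have hκ0 : κ ≠ 0 := by rw [hκ]; exact_mod_cast hk
  have hκpos : 0 < |κ| := abs_pos.2 hκ0
  simp only [← hκ] at hE ⊢
  simp only [hκc] at hE hpde
  obtain ⟨a, ha⟩ : ∃ a : ℝ, a = ν ^ ((1 : ℝ) / 3) := ⟨_, rfl⟩
  obtain ⟨b, hb⟩ : ∃ b : ℝ, b = |κ| ^ ((1 : ℝ) / 3) := ⟨_, rfl⟩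
  have ha0 : 0 < a := ha ▸ Real.rpow_pos_of_pos hν0 _
  have hb0 : 0 < b := hb ▸ Real.rpow_pos_of_pos hκpos _
  have ha3 : ν = a ^ 3 := by
    rw [ha, ← Real.rpow_mul_natCast hν0.le]; norm_num
  have ha2 : ν ^ ((2 : ℝ) / 3) = a ^ 2 := by
    rw [ha, ← Real.rpow_mul_natCast hν0.le]; norm_num
  have ha5 : ν ^ ((5 : ℝ) / 3) = a ^ 5 := by
    rw [ha, ← Real.rpow_mul_natCast hν0.le]; norm_num
  have hb3 : |κ| = b ^ 3 := by
    rw [hb, ← Real.rpow_mul_natCast hκpos.le]; norm_num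
  have hb2 : |κ| ^ ((2 : ℝ) / 3) = b ^ 2 := by
    rw [hb, ← Real.rpow_mul_natCast hκpos.le]; norm_num
  have hc2 : |κ| ^ (-(2 : ℝ) / 3) = b⁻¹ ^ 2 := by
    rw [hb, ← Real.rpow_neg hκpos.le, ← Real.rpow_mul_natCast hκpos.le]; norm_num
  have hc4 : |κ| ^ (-(4 : ℝ) / 3) = b⁻¹ ^ 4 := by
    rw [hb, ← Real.rpow_neg hκpos.le, ← Real.rpow_mul_natCast hκpos.le]; norm_num
  obtain ⟨σ, hσ, hσκ⟩ : ∃ σ : ℝ, σ ^ 2 = 1 ∧ κ = σ * b ^ 3 := by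
    rcases abs_choice κ with h | h
    · exact ⟨1, by norm_num, by linarith⟩
    · exact ⟨-1, by norm_num, by linarith⟩
  rw [ha5, hc2, hb2, ← ha]
  simp only [ha2, hc2, hc4, ← ha] at hE
  have hθy := contDiff_uncurry_deriv_right hθ
  have hθyy := contDiff_uncurry_deriv_right hθy
  have hθt := contDiff_uncurry_deriv_left hθ
  have hθty := contDiff_uncurry_deriv_right hθt
  refine ⟨∫ y in (-1 : ℝ)..1, energyRate (a ^ 2 * b⁻¹ ^ 2) (a * b⁻¹ ^ 4) κ (θ t y) (deriv (θ t) y)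
    (deriv (fun s => θ s y) t) (deriv (fun z => deriv (fun s => θ s z) t) y), ?_, ?_⟩
  · have hEeq : E = fun s => ∫ y in (-1 : ℝ)..1,
        energyDensity (a ^ 2 * b⁻¹ ^ 2) (a * b⁻¹ ^ 4) κ (θ s y) (deriv (θ s) y) := by
      ext s
      rw [hE]
      have c0 : Continuous (θ s) := (hθ.continuous).comp (by fun_prop : Continuous fun y => (s, y))
      have c1 : Continuous (deriv (θ s)) :=
        (hθy.continuous).comp (by fun_prop : Continuous fun y => (s, y))
      have hre := Complex.reCLM.intervalIntegral_comp_comm (μ := MeasureTheory.volume) (a := -1)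
        (b := 1) (Continuous.intervalIntegrable (by fun_prop :
        Continuous fun y => Complex.I * κ * θ s y * (starRingEnd ℂ) (deriv (θ s) y)) _ _)
      simp only [Complex.reCLM_apply] at hre
      rw [← hre, ← intervalIntegral.integral_const_mul, ← intervalIntegral.integral_const_mul,
        ← intervalIntegral.integral_const_mul, ← intervalIntegral.integral_add,
        ← intervalIntegral.integral_add]
      · refine intervalIntegral.integral_congr fun y _ => ?_
        simp [energyDensity, Complex.sq_norm, Complex.normSq_apply]
        ring
      all_goals exact Continuous.intervalIntegrable (by fun_prop) _ _
    rw [hEeq]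
    exact (hasDerivAt_integral_energyDensity hθ _ _ _ t).hasDerivWithinAt
  · have hslice : Continuous fun y : ℝ => (t, y) := by fun_prop
    have cU : Continuous (U t) := hU.continuous.comp hslice
    have cUy : Continuous (deriv (U t)) :=
      (contDiff_uncurry_deriv_right hU).continuous.comp hslice
    have c0 : Continuous (θ t) := hθ.continuous.comp hslice
    have c1 : Continuous (deriv (θ t)) := hθy.continuous.comp hslice
    have c2 : Continuous (deriv (deriv (θ t))) := hθyy.continuous.comp hslice
    have ct : Continuous (fun y => deriv (fun s => θ s y) t) := hθt.continuous.comp hslice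
    have cty : Continuous (deriv (fun z => deriv (fun s => θ s z) t)) :=
      hθty.continuous.comp hslice
    rw [← integral_energyFluxDeriv_eq_zero hU hθ hbd ht ν (a ^ 2 * b⁻¹ ^ 2) (a * b⁻¹ ^ 4) κ]
    simp only [← intervalIntegral.integral_const_mul]
    rw [← intervalIntegral.integral_add, ← intervalIntegral.integral_const_mul,
      ← intervalIntegral.integral_add, ← intervalIntegral.integral_add,
      ← intervalIntegral.integral_const_mul, ← intervalIntegral.integral_add,
      ← intervalIntegral.integral_add]
    · refine intervalIntegral.integral_mono_on (by norm_num) ?_ ?_ fun y hy => ?_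
      · refine Continuous.intervalIntegrable ?_ _ _
        simp only [energyRate]
        fun_prop
      · refine Continuous.intervalIntegrable ?_ _ _
        simp only [energyFluxDeriv]
        fun_prop
      obtain ⟨hu, hu'⟩ := abs_le.1 (hU' t ht y hy)
      have hδ' := hδ.2
      have hdiss := dissipation_density_nonpos (c := b⁻¹) (u := deriv (U t) y) ha0
        (mul_inv_cancel₀ hb0.ne') hσ (by linarith) (by linarith) (θ t y).re (θ t y).im
        (deriv (θ t) y).re (deriv (θ t) y).im (deriv (deriv (θ t)) y).re (deriv (deriv (θ t)) y).im
      rw [← hσκ, ← ha3] at hdiss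
      have hre := congrArg Complex.re (hpde t ht y hy)
      have him := congrArg Complex.im (hpde t ht y hy)
      simp [← Complex.ofReal_pow] at hre him
      simp only [energyRate, energyFluxDeriv, Complex.sq_norm, Complex.normSq_apply]
      linear_combination hdiss
        + (32 * (θ t y).re + 2 * (a * b⁻¹ ^ 4) * κ * (deriv (θ t) y).im
          - 2 * (a ^ 2 * b⁻¹ ^ 2) * (deriv (deriv (θ t)) y).re) * hre
        + (32 * (θ t y).im - 2 * (a * b⁻¹ ^ 4) * κ * (deriv (θ t) y).re
          - 2 * (a ^ 2 * b⁻¹ ^ 2) * (deriv (deriv (θ t)) y).im) * him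
    all_goals
      refine Continuous.intervalIntegrable ?_ _ _
      try simp only [energyRate]
      fun_prop
end

section
/- Let μ > 0 and let W : [0,∞) × [-1,1] → ℝ be smooth, satisfying the heat equation ∂_t W(t,y) = μ·∂_y² W(t,y) for all t ≥ 0 and y ∈ [-1,1], with W(t,-1) = W(t,1) = 0 for all t ≥ 0. Then the function t ↦ Σ_{j=0}^{4} ∫_{-1}^{1} |∂_y^j W(t,y)|² dy is nonincreasing on [0,∞); in particular, for all t ≥ 0, Σ_{j=0}^{4} ‖∂_y^j W(t,·)‖²_{L²} ≤ Σ_{j=0}^{4} ‖∂_y^j W(0,·)‖²_{L²}. -/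
open Set

section PartialDerivatives

variable {F : ℝ → ℝ → ℝ}

lemma hasDerivAt_snd_of_contDiff (hF : ContDiff ℝ (⊤ : ℕ∞) (Function.uncurry F)) (t y : ℝ) :
    HasDerivAt (F t) (fderiv ℝ (Function.uncurry F) (t, y) (0, 1)) y := by
  have h := (hF.differentiable (by simp) (t, y)).hasFDerivAt
  exact h.comp_hasDerivAt y ((hasDerivAt_const y t).prodMk (hasDerivAt_id y))

lemma hasDerivAt_fst_of_contDiff (hF : ContDiff ℝ (⊤ : ℕ∞) (Function.uncurry F)) (t y : ℝ) :
    HasDerivAt (fun s => F s y) (fderiv ℝ (Function.uncurry F) (t, y) (1, 0)) t := by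
  have h := (hF.differentiable (by simp) (t, y)).hasFDerivAt
  exact h.comp_hasDerivAt t ((hasDerivAt_id t).prodMk (hasDerivAt_const t y))

lemma contDiff_fderiv_apply_of_contDiff (hF : ContDiff ℝ (⊤ : ℕ∞) (Function.uncurry F))
    (v : ℝ × ℝ) : ContDiff ℝ (⊤ : ℕ∞) (fun p => fderiv ℝ (Function.uncurry F) p v) :=
  (hF.fderiv_right (by simp)).clm_apply contDiff_const

lemma contDiff_uncurry_deriv_snd (hF : ContDiff ℝ (⊤ : ℕ∞) (Function.uncurry F)) :
    ContDiff ℝ (⊤ : ℕ∞) (Function.uncurry fun t => deriv (F t)) := by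
  convert contDiff_fderiv_apply_of_contDiff hF (0, 1) using 1
  ext ⟨t, y⟩
  exact (hasDerivAt_snd_of_contDiff hF t y).deriv

lemma contDiff_uncurry_deriv_fst (hF : ContDiff ℝ (⊤ : ℕ∞) (Function.uncurry F)) :
    ContDiff ℝ (⊤ : ℕ∞) (Function.uncurry fun t y => deriv (fun s => F s y) t) := by
  convert contDiff_fderiv_apply_of_contDiff hF (1, 0) using 1
  ext ⟨t, y⟩
  exact (hasDerivAt_fst_of_contDiff hF t y).deriv

/-- Partial derivatives of a smooth function commute. -/
lemma deriv_deriv_comm_of_contDiff (hF : ContDiff ℝ (⊤ : ℕ∞) (Function.uncurry F)) (t y : ℝ) :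
    deriv (fun s => deriv (F s) y) t = deriv (fun z => deriv (fun s => F s z) t) y := by
  have hd : DifferentiableAt ℝ (fderiv ℝ (Function.uncurry F)) (t, y) :=
    (hF.fderiv_right (m := (⊤ : ℕ∞)) (by simp)).differentiable (by simp) _
  have hsymm : IsSymmSndFDerivAt ℝ (Function.uncurry F) (t, y) :=
    hF.contDiffAt.isSymmSndFDerivAt (by simpa using WithTop.coe_le_coe.mpr (le_top : (2 : ℕ∞) ≤ ⊤))
  have h₁ := (hasDerivAt_fst_of_contDiff (contDiff_uncurry_deriv_snd hF) t y).deriv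
  have h₂ := (hasDerivAt_snd_of_contDiff (contDiff_uncurry_deriv_fst hF) t y).deriv
  have e₁ : (Function.uncurry fun t => deriv (F t)) =
      fun p => fderiv ℝ (Function.uncurry F) p (0, 1) := by
    ext ⟨t, y⟩
    exact (hasDerivAt_snd_of_contDiff hF t y).deriv
  have e₂ : (Function.uncurry fun t y => deriv (fun s => F s y) t) =
      fun p => fderiv ℝ (Function.uncurry F) p (1, 0) := by
    ext ⟨t, y⟩
    exact (hasDerivAt_fst_of_contDiff hF t y).deriv
  rw [h₁, h₂, e₁, e₂, fderiv_clm_apply hd (by fun_prop), fderiv_clm_apply hd (by fun_prop)]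
  simpa using hsymm (1, 0) (0, 1)

lemma contDiff_uncurry_iterate_deriv_snd (hF : ContDiff ℝ (⊤ : ℕ∞) (Function.uncurry F)) (j : ℕ) :
    ContDiff ℝ (⊤ : ℕ∞) (Function.uncurry fun t => deriv^[j] (F t)) := by
  induction j with
  | zero => exact hF
  | succ j ih =>
    simp only [Function.iterate_succ_apply']
    exact contDiff_uncurry_deriv_snd ih

/-- Differentiation under the integral sign for a smooth integrand. -/
lemma hasDerivAt_intervalIntegral_of_contDiff
    (hF : ContDiff ℝ (⊤ : ℕ∞) (Function.uncurry F)) (a b t : ℝ) :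
    HasDerivAt (fun s => ∫ y in a..b, F s y) (∫ y in a..b, deriv (fun s => F s y) t) t := by
  have hF' := (contDiff_uncurry_deriv_fst hF).continuous
  obtain ⟨C, hC⟩ := ((isCompact_Icc (a := t - 1) (b := t + 1)).prod
    (isCompact_uIcc (a := a) (b := b))).exists_bound_of_continuousOn hF'.continuousOn
  have hcont (s : ℝ) : Continuous (F s) := hF.continuous.comp (Continuous.prodMk_right s)
  have hcont' : Continuous fun y => deriv (fun s => F s y) t :=
    hF'.comp (Continuous.prodMk_right t)
  refine (intervalIntegral.hasDerivAt_integral_of_dominated_loc_of_deriv_le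
    (F' := fun t y => deriv (fun s => F s y) t) (bound := fun _ => C)
    (Icc_mem_nhds (sub_one_lt t) (lt_add_one t))
    (.of_forall fun s => (hcont s).aestronglyMeasurable) ((hcont t).intervalIntegrable _ _)
    hcont'.aestronglyMeasurable ?_ intervalIntegrable_const ?_).2
  · exact .of_forall fun y hy s hs => hC (s, y) ⟨hs, uIoc_subset_uIcc hy⟩
  · exact .of_forall fun y _ s _ =>
      (hasDerivAt_fst_of_contDiff hF s y).differentiableAt.hasDerivAt

end PartialDerivatives

section Heat

variable {μ : ℝ} {F : ℝ → ℝ → ℝ}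

/-- If `F` solves the heat equation at time `t` on a closed interval, then so does `∂_y F`. -/
lemma heat_deriv_snd (hF : ContDiff ℝ (⊤ : ℕ∞) (Function.uncurry F)) {a b t : ℝ} (hab : a < b)
    (hpde : ∀ y ∈ Icc a b, deriv (fun s => F s y) t = μ * deriv (deriv (F t)) y) :
    ∀ y ∈ Icc a b,
      deriv (fun s => deriv (F s) y) t = μ * deriv (deriv (deriv (F t))) y := by
  intro y hy
  have hd := (hasDerivAt_snd_of_contDiff (contDiff_uncurry_deriv_fst hF) t y).differentiableAt
  have hd' := (hasDerivAt_snd_of_contDiff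
    (contDiff_uncurry_deriv_snd (contDiff_uncurry_deriv_snd hF)) t y).differentiableAt
  have hu := uniqueDiffOn_Icc hab y hy
  rw [deriv_deriv_comm_of_contDiff hF, ← hd.derivWithin hu, derivWithin_congr hpde (hpde y hy),
    (hd'.const_mul μ).derivWithin hu, deriv_const_mul μ hd']

lemma heat_iterate_deriv_snd (hF : ContDiff ℝ (⊤ : ℕ∞) (Function.uncurry F)) {a b t : ℝ}
    (hab : a < b) (hpde : ∀ y ∈ Icc a b, deriv (fun s => F s y) t = μ * deriv (deriv (F t)) y)
    (j : ℕ) : ∀ y ∈ Icc a b,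
      deriv (fun s => deriv^[j] (F s) y) t = μ * deriv^[j + 2] (F t) y := by
  induction j with
  | zero => exact hpde
  | succ j ih =>
    simp only [Function.iterate_succ_apply'] at ih ⊢
    exact heat_deriv_snd (F := fun t => deriv^[j] (F t))
      (contDiff_uncurry_iterate_deriv_snd hF j) hab ih

/-- The `L²` norm of a smooth solution of the heat equation is nonincreasing if `F * ∂_y F`
vanishes at the boundary. -/
lemma antitoneOn_integral_sq_of_heat (hμ : 0 ≤ μ)
    (hF : ContDiff ℝ (⊤ : ℕ∞) (Function.uncurry F)) {a b : ℝ} (hab : a ≤ b)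
    (hpde : ∀ t > 0, ∀ y ∈ Icc a b, deriv (fun s => F s y) t = μ * deriv (deriv (F t)) y)
    (ha : ∀ t > 0, F t a * deriv (F t) a = 0) (hb : ∀ t > 0, F t b * deriv (F t) b = 0) :
    AntitoneOn (fun t => ∫ y in a..b, (F t y) ^ 2) (Ici 0) := by
  have hder (t : ℝ) := hasDerivAt_intervalIntegral_of_contDiff (F := fun t y => (F t y) ^ 2)
    (hF.pow 2) a b t
  refine antitoneOn_of_deriv_nonpos (convex_Ici 0)
    (fun t _ => (hder t).continuousAt.continuousWithinAt)
    (fun t _ => (hder t).differentiableAt.differentiableWithinAt) fun t ht => ?_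
  rw [interior_Ici] at ht
  have hF₁ := contDiff_uncurry_deriv_snd hF
  have hF₂ := contDiff_uncurry_deriv_snd hF₁
  have hc₁ : Continuous (deriv (F t)) := hF₁.continuous.comp (Continuous.prodMk_right t)
  have hc₂ : Continuous (deriv (deriv (F t))) := hF₂.continuous.comp (Continuous.prodMk_right t)
  have hparts := intervalIntegral.integral_mul_deriv_eq_deriv_mul (a := a) (b := b)
    (u := F t) (v := deriv (F t))
    (fun y _ => (hasDerivAt_snd_of_contDiff hF t y).differentiableAt.hasDerivAt)
    (fun y _ => (hasDerivAt_snd_of_contDiff hF₁ t y).differentiableAt.hasDerivAt)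
    (hc₁.intervalIntegrable _ _) (hc₂.intervalIntegrable _ _)
  have hcongr : ∫ y in a..b, deriv (fun s => (F s y) ^ 2) t =
      ∫ y in a..b, (2 * μ) * (F t y * deriv (deriv (F t)) y) := by
    refine intervalIntegral.integral_congr fun y hy => ?_
    rw [uIcc_of_le hab] at hy
    have h := (hasDerivAt_fst_of_contDiff hF t y).differentiableAt.hasDerivAt.pow 2
    rw [hpde t ht y hy] at h
    refine Eq.trans h.deriv ?_
    simp
    ring
  have hnonneg : 0 ≤ ∫ y in a..b, deriv (F t) y * deriv (F t) y :=
    intervalIntegral.integral_nonneg hab fun y _ => mul_self_nonneg _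
  rw [(hder t).deriv, hcongr, intervalIntegral.integral_const_mul, hparts, ha t ht, hb t ht]
  nlinarith [mul_nonneg hμ hnonneg]

/-- Even-order spatial derivatives of a solution of the heat equation vanish wherever the solution
vanishes for all positive times. -/
lemma iterate_deriv_even_eq_zero_of_heat (hμ : μ ≠ 0) {y : ℝ}
    (hpde : ∀ j : ℕ, ∀ t > 0,
      deriv (fun s => deriv^[j] (F s) y) t = μ * deriv^[j + 2] (F t) y)
    (h0 : ∀ t > 0, F t y = 0) (k : ℕ) : ∀ t > 0, deriv^[2 * k] (F t) y = 0 := by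
  induction k with
  | zero => exact h0
  | succ k ih =>
    intro t ht
    have heq : (fun s => deriv^[2 * k] (F s) y) =ᶠ[nhds t] fun _ => 0 := by
      filter_upwards [Ioi_mem_nhds ht] with s hs using ih s hs
    have h := hpde (2 * k) t ht
    rw [heq.deriv_eq, deriv_const] at h
    exact (mul_eq_zero.mp h.symm).resolve_left hμ

end Heat

theorem stmt_18 (μ : ℝ) (hμ : 0 < μ)
    (W : ℝ → ℝ → ℝ) (hW : ContDiff ℝ (⊤ : ℕ∞) (Function.uncurry W))
    (hpde : ∀ t ≥ (0:ℝ), ∀ y ∈ Icc (-1:ℝ) 1,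
      deriv (fun s => W s y) t = μ * deriv (deriv (W t)) y)
    (hbd : ∀ t ≥ (0:ℝ), W t (-1) = 0 ∧ W t 1 = 0) :
    AntitoneOn (fun t => ∑ j ∈ Finset.range 5,
        ∫ y in (-1:ℝ)..1, (deriv^[j] (W t) y)^2) (Ici 0) ∧
      ∀ t ≥ (0:ℝ),
        (∑ j ∈ Finset.range 5, ∫ y in (-1:ℝ)..1, (deriv^[j] (W t) y)^2) ≤
          ∑ j ∈ Finset.range 5, ∫ y in (-1:ℝ)..1, (deriv^[j] (W 0) y)^2 := by
  have hpde' (j : ℕ) (t : ℝ) (ht : t > 0) :=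
    heat_iterate_deriv_snd hW (by norm_num) (hpde t ht.le) j
  have hzero {y : ℝ} (hy : y ∈ Icc (-1 : ℝ) 1) (h0 : ∀ t > 0, W t y = 0) (j : ℕ) (t : ℝ)
      (ht : t > 0) : deriv^[j] (W t) y * deriv (deriv^[j] (W t)) y = 0 := by
    have heven := iterate_deriv_even_eq_zero_of_heat hμ.ne' (fun j t ht => hpde' j t ht y hy) h0
    rw [← Function.iterate_succ_apply' deriv]
    obtain ⟨k, rfl | rfl⟩ := j.even_or_odd'
    · rw [heven k t ht, zero_mul]
    · rw [show (2 * k + 1).succ = 2 * (k + 1) by lia, heven (k + 1) t ht, mul_zero]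
  have hanti : AntitoneOn (fun t => ∑ j ∈ Finset.range 5,
      ∫ y in (-1:ℝ)..1, (deriv^[j] (W t) y)^2) (Ici 0) := by
    intro s hs t ht hst
    refine Finset.sum_le_sum fun j _ => ?_
    refine antitoneOn_integral_sq_of_heat (F := fun t => deriv^[j] (W t)) hμ.le
      (contDiff_uncurry_iterate_deriv_snd hW j) (by norm_num) ?_
      (hzero (by simp) (fun t ht => (hbd t ht.le).1) j)
      (hzero (by simp) (fun t ht => (hbd t ht.le).2) j) hs ht hst
    intro t ht y hy
    simpa only [Function.iterate_succ_apply'] using hpde' j t ht y hy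
  exact ⟨hanti, fun t ht => hanti self_mem_Ici ht ht⟩
end
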